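/- Let U ⊆ ℝ³ be open, let Φ : U → ℝ³ be a C³ orthogonal curvilinear coordinate map (pairwise orthogonal nonvanishing partials, metric coefficients hᵢ, right-handed frame uᵢ), let μ > 0 and λ > −(2/3)μ be real, and let f⃗ ∈ C²(Ω; ℂ³) be a vector field on an open set Ω with Φ(U) ⊆ Ω, with component functions F₁,F₂,F₃ : U → ℂ defined by f⃗(Φ(q)) = F₁(q)u₁(q) + F₂(q)u₂(q) + F₃(q)u₃(q). Then for every q ∈ U the Lamé–Navier operator ℒ_{λ,μ}[f⃗] := μ(grad[div[f⃗]] − curl[curl[f⃗]]) + (μ+λ)grad[div[f⃗]] satisfies: the u₁-component of ℒ_{λ,μ}[f⃗](Φ(q)) equals ((2μ+λ)/h₁)∂/∂q₁[(1/(h₁h₂h₃))∂(h₂h₃F₁)/∂q₁] + ((2μ+λ)/h₁)∂/∂q₁[(1/(h₁h₂h₃))∂(h₁h₃F₂)/∂q₂] + ((2μ+λ)/h₁)∂/∂q₁[(1/(h₁h₂h₃))∂(h₁h₂F₃)/∂q₃] − (μ/(h₂h₃))∂/∂q₂[(h₃/(h₁h₂))∂(h₂F₂)/∂q₁] + (μ/(h₂h₃))∂/∂q₂[(h₃/(h₁h₂))∂(h₁F₁)/∂q₂]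 + (μ/(h₂h₃))∂/∂q₃[(h₂/(h₁h₃))∂(h₁F₁)/∂q₃] − (μ/(h₂h₃))∂/∂q₃[(h₂/(h₁h₃))∂(h₃F₃)/∂q₁], and the u₂- and u₃-components are obtained from this expression by the cyclic permutations (1→2→3→1) and (1→3→2→1) of all indices on h, F and q respectively. -/

import Mathlib

open Quaternion

noncomputable section

/-- Points of `ℝ³`. -/
abbrev P3 := Fin 3 → ℝ
/-- Vectors of `ℂ³`. -/
abbrev V3 := Fin 3 → ℂ

/-- Partial derivative `∂g/∂qᵢ` of a complex-valued function on `ℝ³`. -/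
def pd (i : Fin 3) (g : P3 → ℂ) : P3 → ℂ := fun p => fderiv ℝ g p (Pi.single i 1)

/-- Gradient of a scalar field, extended ℂ-linearly. -/
def grad (g : P3 → ℂ) : P3 → V3 := fun p => ![pd 0 g p, pd 1 g p, pd 2 g p]

/-- Divergence of a `ℂ³`-valued vector field. -/
def div3 (F : P3 → V3) : P3 → ℂ := fun p =>
  pd 0 (fun q => F q 0) p + pd 1 (fun q => F q 1) p + pd 2 (fun q => F q 2) p

/-- Curl of a `ℂ³`-valued vector field. -/
def curl (F : P3 → V3) : P3 → V3 := fun p =>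
  ![pd 1 (fun q => F q 2) p - pd 2 (fun q => F q 1) p,
    pd 2 (fun q => F q 0) p - pd 0 (fun q => F q 2) p,
    pd 0 (fun q => F q 1) p - pd 1 (fun q => F q 0) p]

/-- Scalar Laplacian `∂²/∂x² + ∂²/∂y² + ∂²/∂z²` of a complex-valued function. -/
def lap (g : P3 → ℂ) : P3 → ℂ := fun p =>
  pd 0 (pd 0 g) p + pd 1 (pd 1 g) p + pd 2 (pd 2 g) p

/-- A `ℂ³`-valued field is `Cⁿ` on a set iff each component is. -/
def VContDiffOn (n : ℕ) (F : P3 → V3) (Ω : Set P3) : Prop :=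
  ∀ i : Fin 3, ContDiffOn ℝ n (fun q => F q i) Ω

/-- Real (bilinear) dot product on `ℝ³`. -/
def dotR (v w : P3) : ℝ := v 0 * w 0 + v 1 * w 1 + v 2 * w 2

/-- Complex bilinear "inner product" on `ℂ³` (no conjugation). -/
def dotC (v w : V3) : ℂ := v 0 * w 0 + v 1 * w 1 + v 2 * w 2

/-- Cross product on `ℝ³`. -/
def crossR (v w : P3) : P3 :=
  ![v 1 * w 2 - v 2 * w 1, v 2 * w 0 - v 0 * w 2, v 0 * w 1 - v 1 * w 0]

/-- A real vector of `ℝ³` viewed inside `ℂ³`. -/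
def c3 (v : P3) : V3 := fun i => (v i : ℂ)

/-- Partial derivative `∂Φ/∂qᵢ` of a map `Φ : ℝ³ → ℝ³`. -/
def pdv (i : Fin 3) (Φ : P3 → P3) (q : P3) : P3 := fderiv ℝ Φ q (Pi.single i 1)

/-- `Φ` is an orthogonal curvilinear coordinate map on `U`: its partial derivatives
are pairwise orthogonal and nonvanishing at each point of `U`. -/
def IsOrthogonalCurvilinear (Φ : P3 → P3) (U : Set P3) : Prop :=
  ∀ q ∈ U, (∀ i j : Fin 3, i ≠ j → dotR (pdv i Φ q) (pdv j Φ q) = 0) ∧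
    ∀ i : Fin 3, pdv i Φ q ≠ 0

/-- Metric (Lamé) coefficient `hᵢ(q) = ‖∂Φ/∂qᵢ(q)‖` (Euclidean norm). -/
def mcoef (Φ : P3 → P3) (i : Fin 3) (q : P3) : ℝ :=
  Real.sqrt (dotR (pdv i Φ q) (pdv i Φ q))

/-- Orthonormal frame `uᵢ(q) = hᵢ(q)⁻¹ ∂Φ/∂qᵢ(q)`. -/
def frame (Φ : P3 → P3) (i : Fin 3) (q : P3) : P3 := (mcoef Φ i q)⁻¹ • pdv i Φ q

/-- The frame is right-handed: `u₁ × u₂ = u₃` on `U`. -/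
def IsRightHanded (Φ : P3 → P3) (U : Set P3) : Prop :=
  ∀ q ∈ U, crossR (frame Φ 0 q) (frame Φ 1 q) = frame Φ 2 q

/-- Frame vector `uᵢ(q)` viewed inside `ℂ³`. -/
def frameC (Φ : P3 → P3) (i : Fin 3) (q : P3) : V3 := c3 (frame Φ i q)

/-- Metric coefficient `hᵢ(q)` viewed as a complex number. -/
def hC (Φ : P3 → P3) (i : Fin 3) (q : P3) : ℂ := ((mcoef Φ i q : ℝ) : ℂ)


/-- The generic `uᵢ`-component expression for the Lamé–Navier operator
`ℒ_{λ,μ} = μ(grad∘div − curl∘curl) + (μ+λ) grad∘div` in orthogonal curvilinear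
coordinates; the components are obtained by the cyclic substitutions
`(i,j,k) = (1,2,3), (2,3,1), (3,1,2)`. -/
def lameCurvExpr (Φ : P3 → P3) (F : Fin 3 → P3 → ℂ) (mu lam : ℝ) (i j k : Fin 3) : P3 → ℂ := fun q =>
    (((2 * mu + lam : ℝ) : ℂ) / hC Φ i q) *
      pd i (fun r => (1 / (hC Φ i r * hC Φ j r * hC Φ k r)) *
        pd i (fun s => hC Φ j s * hC Φ k s * F i s) r) q
    + (((2 * mu + lam : ℝ) : ℂ) / hC Φ i q) *
      pd i (fun r => (1 / (hC Φ i r * hC Φ j r * hC Φ k r)) *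
        pd j (fun s => hC Φ i s * hC Φ k s * F j s) r) q
    + (((2 * mu + lam : ℝ) : ℂ) / hC Φ i q) *
      pd i (fun r => (1 / (hC Φ i r * hC Φ j r * hC Φ k r)) *
        pd k (fun s => hC Φ i s * hC Φ j s * F k s) r) q
    - (((mu : ℝ) : ℂ) / (hC Φ j q * hC Φ k q)) *
      pd j (fun r => (hC Φ k r / (hC Φ i r * hC Φ j r)) *
        pd i (fun s => hC Φ j s * F j s) r) q
    + (((mu : ℝ) : ℂ) / (hC Φ j q * hC Φ k q)) *
      pd j (fun r => (hC Φ k r / (hC Φ i r * hC Φ j r)) *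
        pd j (fun s => hC Φ i s * F i s) r) q
    + (((mu : ℝ) : ℂ) / (hC Φ j q * hC Φ k q)) *
      pd k (fun r => (hC Φ j r / (hC Φ i r * hC Φ k r)) *
        pd k (fun s => hC Φ i s * F i s) r) q
    - (((mu : ℝ) : ℂ) / (hC Φ j q * hC Φ k q)) *
      pd k (fun r => (hC Φ j r / (hC Φ i r * hC Φ k r)) *
        pd i (fun s => hC Φ k s * F k s) r) q

section PartialDerivatives

variable {U : Set P3} {q : P3} {g g' : P3 → ℂ}

lemma pd_congr_of_eqOn (hU : IsOpen U) (hq : q ∈ U) (h : Set.EqOn g g' U) (i : Fin 3) :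
    pd i g q = pd i g' q := by
  unfold pd
  rw [(h.eventuallyEq_of_mem (hU.mem_nhds hq)).fderiv_eq]

lemma pd_add (hg : DifferentiableAt ℝ g q) (hg' : DifferentiableAt ℝ g' q) (i : Fin 3) :
    pd i (fun s => g s + g' s) q = pd i g q + pd i g' q := by
  simp [pd, fderiv_fun_add hg hg']

lemma pd_sub (hg : DifferentiableAt ℝ g q) (hg' : DifferentiableAt ℝ g' q) (i : Fin 3) :
    pd i (fun s => g s - g' s) q = pd i g q - pd i g' q := by
  simp [pd, fderiv_fun_sub hg hg']

lemma pd_mul (hg : DifferentiableAt ℝ g q) (hg' : DifferentiableAt ℝ g' q) (i : Fin 3) :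
    pd i (fun s => g s * g' s) q = pd i g q * g' q + g q * pd i g' q := by
  simp [pd, fderiv_fun_mul hg hg']
  ring

lemma contDiffOn_pd {m n : WithTop ℕ∞} (hU : IsOpen U) (hg : ContDiffOn ℝ n g U)
    (hmn : m + 1 ≤ n) (i : Fin 3) : ContDiffOn ℝ m (pd i g) U :=
  (hg.fderiv_of_isOpen hU hmn).clm_apply contDiffOn_const

lemma pd_comm (hg : ContDiffAt ℝ 2 g q) (i j : Fin 3) :
    pd i (pd j g) q = pd j (pd i g) q := by
  have hd : DifferentiableAt ℝ (fderiv ℝ g) q :=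
    (hg.fderiv_right (m := 1) (by norm_num)).differentiableAt (by norm_num)
  have key (v w : P3) : fderiv ℝ (fun p => fderiv ℝ g p v) q w = fderiv ℝ (fderiv ℝ g) q w v := by
    rw [fderiv_clm_apply hd (differentiableAt_const v)]
    simp
  have hs := hg.isSymmSndFDerivAt (by simp)
  simp only [pd]
  exact (key _ _).trans ((hs _ _).trans (key _ _).symm)

lemma pd_comp {Φ : P3 → P3} (hg : DifferentiableAt ℝ g (Φ q)) (hΦ : DifferentiableAt ℝ Φ q)
    (i : Fin 3) :
    pd i (fun s => g (Φ s)) q = dotC (grad g (Φ q)) (c3 (pdv i Φ q)) := by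
  have h : pd i (fun s => g (Φ s)) q = fderiv ℝ g (Φ q) (pdv i Φ q) := by
    unfold pd pdv
    rw [show (fun s => g (Φ s)) = g ∘ Φ from rfl, fderiv_comp _ hg hΦ]
    rfl
  rw [h]
  have e (v : P3) : v = ∑ b, v b • Pi.single b (1 : ℝ) := by
    ext j
    simp [Finset.sum_apply, Pi.single_apply]
  conv_lhs => rw [e (pdv i Φ q)]
  rw [map_sum]
  simp only [map_smul, Fin.sum_univ_three, dotC, grad, pd, c3, Complex.real_smul, Matrix.cons_val]
  ring

lemma pd_dotC {A B : P3 → V3} (hA : ∀ a, DifferentiableAt ℝ (fun s => A s a) q)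
    (hB : ∀ a, DifferentiableAt ℝ (fun s => B s a) q) (i : Fin 3) :
    pd i (fun s => dotC (A s) (B s)) q =
      dotC (fun a => pd i (fun s => A s a) q) (B q) +
        dotC (A q) (fun a => pd i (fun s => B s a) q) := by
  simp only [dotC]
  rw [pd_add (((hA 0).fun_mul (hB 0)).fun_add ((hA 1).fun_mul (hB 1))) ((hA 2).fun_mul (hB 2)),
    pd_add ((hA 0).fun_mul (hB 0)) ((hA 1).fun_mul (hB 1)),
    pd_mul (hA 0) (hB 0), pd_mul (hA 1) (hB 1), pd_mul (hA 2) (hB 2)]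
  ring

end PartialDerivatives

/-- The coordinate tangent vector `∂Φ/∂qᵢ` viewed inside `ℂ³`. -/
def tangentC (Φ : P3 → P3) (i : Fin 3) (q : P3) : V3 := c3 (pdv i Φ q)

/-- Cross product on `ℂ³` (bilinear). -/
def crossC (v w : V3) : V3 :=
  ![v 1 * w 2 - v 2 * w 1, v 2 * w 0 - v 0 * w 2, v 0 * w 1 - v 1 * w 0]

lemma pd_crossC {q : P3} {A B : P3 → V3} (hA : ∀ a, DifferentiableAt ℝ (fun s => A s a) q)
    (hB : ∀ a, DifferentiableAt ℝ (fun s => B s a) q) (i a : Fin 3) :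
    pd i (fun s => crossC (A s) (B s) a) q =
      crossC (fun b => pd i (fun s => A s b) q) (B q) a +
        crossC (A q) (fun b => pd i (fun s => B s b) q) a := by
  have key (b c : Fin 3) : pd i (fun s => A s b * B s c - A s c * B s b) q =
      (pd i (fun s => A s b) q * B q c - pd i (fun s => A s c) q * B q b) +
        (A q b * pd i (fun s => B s c) q - A q c * pd i (fun s => B s b) q) := by
    rw [pd_sub ((hA b).fun_mul (hB c)) ((hA c).fun_mul (hB b)), pd_mul (hA b) (hB c),
      pd_mul (hA c) (hB b)]
    ring
  fin_cases a
  exacts [key 1 2, key 2 0, key 0 1]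

lemma differentiableAt_crossC {q : P3} {A B : P3 → V3}
    (hA : ∀ a, DifferentiableAt ℝ (fun s => A s a) q)
    (hB : ∀ a, DifferentiableAt ℝ (fun s => B s a) q) (a : Fin 3) :
    DifferentiableAt ℝ (fun s => crossC (A s) (B s) a) q := by
  have key (b c : Fin 3) : DifferentiableAt ℝ (fun s => A s b * B s c - A s c * B s b) q :=
    ((hA b).mul (hB c)).sub ((hA c).mul (hB b))
  fin_cases a
  exacts [key 1 2, key 2 0, key 0 1]

section Tangent

variable {U : Set P3} {Φ : P3 → P3} {q : P3}

lemma contDiffOn_pdv (hU : IsOpen U) {m n : WithTop ℕ∞} (hΦ : ContDiffOn ℝ n Φ U)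
    (hmn : m + 1 ≤ n) (i a : Fin 3) : ContDiffOn ℝ m (fun s => pdv i Φ s a) U :=
  contDiffOn_pi.1 ((hΦ.fderiv_of_isOpen hU hmn).clm_apply contDiffOn_const) a

lemma contDiffOn_tangentC (hU : IsOpen U) {m n : WithTop ℕ∞} (hΦ : ContDiffOn ℝ n Φ U)
    (hmn : m + 1 ≤ n) (i a : Fin 3) : ContDiffOn ℝ m (fun s => tangentC Φ i s a) U :=
  Complex.ofRealCLM.contDiff.comp_contDiffOn (contDiffOn_pdv hU hΦ hmn i a)

lemma tangentC_eq_pd (hΦ : DifferentiableAt ℝ Φ q) (i a : Fin 3) :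
    tangentC Φ i q a = pd i (fun s => (Φ s a : ℂ)) q := by
  have h := (Complex.ofRealCLM.hasFDerivAt (x := Φ q a)).comp q
    (hasFDerivAt_pi'.1 hΦ.hasFDerivAt a)
  have h' : HasFDerivAt (fun s => (Φ s a : ℂ)) _ q := h
  rw [pd, h'.fderiv]
  rfl

lemma pd_tangentC_comm (hU : IsOpen U) (hΦ : ContDiffOn ℝ 2 Φ U) (hq : q ∈ U) (i j a : Fin 3) :
    pd i (fun s => tangentC Φ j s a) q = pd j (fun s => tangentC Φ i s a) q := by
  have hd : ∀ s ∈ U, DifferentiableAt ℝ Φ s := fun s hs =>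
    (hΦ.contDiffAt (hU.mem_nhds hs)).differentiableAt (by norm_num)
  rw [pd_congr_of_eqOn hU hq (fun s hs => tangentC_eq_pd (hd s hs) j a),
    pd_congr_of_eqOn hU hq (fun s hs => tangentC_eq_pd (hd s hs) i a)]
  exact pd_comm (Complex.ofRealCLM.contDiff.contDiffAt.comp q
    (contDiffAt_pi.1 (hΦ.contDiffAt (hU.mem_nhds hq)) a)) i j

/-- Pull-back of the exterior derivative: the curl paired with a coordinate area element. -/
lemma pd_dotC_tangentC_sub (hU : IsOpen U) (hΦ : ContDiffOn ℝ 2 Φ U) (hq : q ∈ U)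
    {f : P3 → V3} (hf : ∀ a, DifferentiableAt ℝ (fun p => f p a) (Φ q)) (i j : Fin 3) :
    pd i (fun s => dotC (f (Φ s)) (tangentC Φ j s)) q -
        pd j (fun s => dotC (f (Φ s)) (tangentC Φ i s)) q =
      dotC (curl f (Φ q)) (crossC (tangentC Φ i q) (tangentC Φ j q)) := by
  have hd : DifferentiableAt ℝ Φ q :=
    (hΦ.contDiffAt (hU.mem_nhds hq)).differentiableAt (by norm_num)
  have hT (i a) : DifferentiableAt ℝ (fun s => tangentC Φ i s a) q :=
    ((contDiffOn_tangentC hU hΦ (m := 1) (by norm_num) i a).contDiffAt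
      (hU.mem_nhds hq)).differentiableAt (by norm_num)
  have hfΦ (a) : DifferentiableAt ℝ (fun s => f (Φ s) a) q := (hf a).comp q hd
  have hch (i a) : pd i (fun s => f (Φ s) a) q =
      dotC (grad (fun p => f p a) (Φ q)) (tangentC Φ i q) := pd_comp (hf a) hd i
  rw [pd_dotC hfΦ (hT j), pd_dotC hfΦ (hT i)]
  simp only [hch, pd_tangentC_comm hU hΦ hq j i]
  simp only [dotC, grad, curl, crossC, Matrix.cons_val]
  ring

/-- Pull-back of the divergence as a flux through coordinate area elements. -/
lemma sum_pd_dotC_crossC (hU : IsOpen U) (hΦ : ContDiffOn ℝ 2 Φ U) (hq : q ∈ U)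
    {f : P3 → V3} (hf : ∀ a, DifferentiableAt ℝ (fun p => f p a) (Φ q)) (i j k : Fin 3) :
    pd i (fun s => dotC (f (Φ s)) (crossC (tangentC Φ j s) (tangentC Φ k s))) q +
      pd j (fun s => dotC (f (Φ s)) (crossC (tangentC Φ k s) (tangentC Φ i s))) q +
      pd k (fun s => dotC (f (Φ s)) (crossC (tangentC Φ i s) (tangentC Φ j s))) q =
      div3 f (Φ q) * dotC (tangentC Φ i q) (crossC (tangentC Φ j q) (tangentC Φ k q)) := by
  have hd : DifferentiableAt ℝ Φ q :=
    (hΦ.contDiffAt (hU.mem_nhds hq)).differentiableAt (by norm_num)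
  have hT (i a) : DifferentiableAt ℝ (fun s => tangentC Φ i s a) q :=
    ((contDiffOn_tangentC hU hΦ (m := 1) (by norm_num) i a).contDiffAt
      (hU.mem_nhds hq)).differentiableAt (by norm_num)
  have hfΦ (a) : DifferentiableAt ℝ (fun s => f (Φ s) a) q := (hf a).comp q hd
  have hch (i a) : pd i (fun s => f (Φ s) a) q =
      dotC (grad (fun p => f p a) (Φ q)) (tangentC Φ i q) := pd_comp (hf a) hd i
  rw [pd_dotC hfΦ (differentiableAt_crossC (hT j) (hT k)),
    pd_dotC hfΦ (differentiableAt_crossC (hT k) (hT i)),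
    pd_dotC hfΦ (differentiableAt_crossC (hT i) (hT j))]
  simp only [hch, pd_crossC (hT _) (hT _), pd_tangentC_comm hU hΦ hq j i,
    pd_tangentC_comm hU hΦ hq k i, pd_tangentC_comm hU hΦ hq k j]
  simp only [dotC, grad, div3, crossC, Matrix.cons_val]
  ring

end Tangent

section Frame

variable {U : Set P3} {Φ : P3 → P3} {q : P3}

lemma dotR_self_pos {v : P3} (hv : v ≠ 0) : 0 < dotR v v := by
  have h : 0 ≤ dotR v v := by
    unfold dotR
    nlinarith [sq_nonneg (v 0), sq_nonneg (v 1), sq_nonneg (v 2)]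
  refine h.lt_of_ne fun h0 => hv ?_
  unfold dotR at h0
  ext a
  fin_cases a <;> simp <;> nlinarith [sq_nonneg (v 0), sq_nonneg (v 1), sq_nonneg (v 2)]

lemma mcoef_pos (h : IsOrthogonalCurvilinear Φ U) (hq : q ∈ U) (i : Fin 3) : 0 < mcoef Φ i q :=
  Real.sqrt_pos.2 (dotR_self_pos ((h q hq).2 i))

lemma hC_ne_zero (h : IsOrthogonalCurvilinear Φ U) (hq : q ∈ U) (i : Fin 3) : hC Φ i q ≠ 0 :=
  Complex.ofReal_ne_zero.2 (mcoef_pos h hq i).ne'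

lemma contDiffOn_hC (hU : IsOpen U) (hΦ : ContDiffOn ℝ 3 Φ U) (h : IsOrthogonalCurvilinear Φ U)
    (i : Fin 3) : ContDiffOn ℝ 2 (hC Φ i) U := by
  have hp (a) := contDiffOn_pdv hU hΦ (m := 2) (by norm_num) i a
  exact Complex.ofRealCLM.contDiff.comp_contDiffOn <|
    ((((hp 0).mul (hp 0)).add ((hp 1).mul (hp 1))).add ((hp 2).mul (hp 2))).sqrt
      fun s hs => (dotR_self_pos ((h s hs).2 i)).ne'

lemma frameC_eq (i : Fin 3) : frameC Φ i q = (hC Φ i q)⁻¹ • tangentC Φ i q := by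
  ext a
  simp [frameC, frame, c3, hC, tangentC]

lemma tangentC_eq (h : IsOrthogonalCurvilinear Φ U) (hq : q ∈ U) (i : Fin 3) :
    tangentC Φ i q = hC Φ i q • frameC Φ i q := by
  rw [frameC_eq, smul_inv_smul₀ (hC_ne_zero h hq i)]

lemma dotC_smul_left (c : ℂ) (v w : V3) : dotC (c • v) w = c * dotC v w := by
  simp only [dotC, Pi.smul_apply, smul_eq_mul]; ring

lemma dotC_smul_right (c : ℂ) (v w : V3) : dotC v (c • w) = c * dotC v w := by
  simp only [dotC, Pi.smul_apply, smul_eq_mul]; ring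

lemma dotC_add_left (u v w : V3) : dotC (u + v) w = dotC u w + dotC v w := by
  simp only [dotC, Pi.add_apply]; ring

lemma dotC_sub_left (u v w : V3) : dotC (u - v) w = dotC u w - dotC v w := by
  simp only [dotC, Pi.sub_apply]; ring

lemma crossC_smul_smul (c d : ℂ) (v w : V3) : crossC (c • v) (d • w) = (c * d) • crossC v w := by
  ext a
  fin_cases a <;> simp [crossC] <;> ring

lemma dotR_frame (h : IsOrthogonalCurvilinear Φ U) (hq : q ∈ U) (i j : Fin 3) :
    dotR (frame Φ i q) (frame Φ j q) = if i = j then 1 else 0 := by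
  have e : dotR (frame Φ i q) (frame Φ j q) =
      (mcoef Φ i q)⁻¹ * (mcoef Φ j q)⁻¹ * dotR (pdv i Φ q) (pdv j Φ q) := by
    simp only [frame, dotR, Pi.smul_apply, smul_eq_mul]; ring
  rw [e]
  split_ifs with hij
  · subst hij
    have hm := (mcoef_pos h hq i).ne'
    have hs : dotR (pdv i Φ q) (pdv i Φ q) = mcoef Φ i q * mcoef Φ i q :=
      (Real.mul_self_sqrt (dotR_self_pos ((h q hq).2 i)).le).symm
    rw [hs]
    field_simp
  · rw [(h q hq).1 i j hij, mul_zero]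

lemma dotC_frameC (h : IsOrthogonalCurvilinear Φ U) (hq : q ∈ U) (i j : Fin 3) :
    dotC (frameC Φ i q) (frameC Φ j q) = if i = j then 1 else 0 := by
  have := congrArg (fun x : ℝ => (x : ℂ)) (dotR_frame h hq i j)
  simpa [dotR, dotC, frameC, c3, apply_ite Complex.ofReal] using this

lemma crossC_crossC_left (u v w : V3) :
    crossC (crossC u v) w = dotC u w • v - dotC v w • u := by
  ext a
  fin_cases a <;> simp [crossC, dotC] <;> ring

lemma crossC_crossC_right (u v w : V3) :
    crossC u (crossC v w) = dotC u w • v - dotC u v • w := by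
  ext a
  fin_cases a <;> simp [crossC, dotC] <;> ring

lemma crossC_frameC (h : IsOrthogonalCurvilinear Φ U) (hrh : IsRightHanded Φ U) (hq : q ∈ U)
    (i : Fin 3) : crossC (frameC Φ i q) (frameC Φ (i + 1) q) = frameC Φ (i + 2) q := by
  have h01 : crossC (frameC Φ 0 q) (frameC Φ 1 q) = frameC Φ 2 q := by
    ext a
    rw [frameC, frameC, frameC, ← hrh q hq]
    fin_cases a <;> simp [crossC, crossR, c3]
  fin_cases i
  · exact h01
  · change crossC (frameC Φ 1 q) (frameC Φ 2 q) = frameC Φ 0 q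
    rw [← h01, crossC_crossC_right]
    simp [dotC_frameC h hq]
  · change crossC (frameC Φ 2 q) (frameC Φ 0 q) = frameC Φ 1 q
    rw [← h01, crossC_crossC_left]
    simp [dotC_frameC h hq]

lemma crossC_tangentC (h : IsOrthogonalCurvilinear Φ U) (hrh : IsRightHanded Φ U) (hq : q ∈ U)
    {i j k : Fin 3} (hj : j = i + 1) (hk : k = i + 2) :
    crossC (tangentC Φ i q) (tangentC Φ j q) = (hC Φ i q * hC Φ j q) • frameC Φ k q := by
  rw [tangentC_eq h hq, tangentC_eq h hq, crossC_smul_smul, hj, crossC_frameC h hrh hq, hk]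

end Frame

lemma contDiffOn_div3 {Ω : Set P3} (hΩ : IsOpen Ω) {f : P3 → V3} (hf : VContDiffOn 2 f Ω) :
    ContDiffOn ℝ 1 (div3 f) Ω := by
  have h (i a) := contDiffOn_pd hΩ (hf a) (m := 1) (by norm_num) i
  exact ((h 0 0).add (h 1 1)).add (h 2 2)

lemma contDiffOn_curl {Ω : Set P3} (hΩ : IsOpen Ω) {f : P3 → V3} (hf : VContDiffOn 2 f Ω) :
    VContDiffOn 1 (curl f) Ω := by
  have h (i a) := contDiffOn_pd hΩ (hf a) (m := 1) (by norm_num) i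
  intro a
  fin_cases a
  exacts [(h 1 2).sub (h 2 1), (h 2 0).sub (h 0 2), (h 0 1).sub (h 1 0)]

section Lame

variable {U Ω : Set P3} {Φ : P3 → P3} {f : P3 → V3} {F : Fin 3 → P3 → ℂ} {q : P3}

lemma dotC_frameC_of_decomp (h : IsOrthogonalCurvilinear Φ U)
    (hdec : ∀ q ∈ U, f (Φ q) =
      F 0 q • frameC Φ 0 q + F 1 q • frameC Φ 1 q + F 2 q • frameC Φ 2 q)
    (hq : q ∈ U) (i : Fin 3) : dotC (f (Φ q)) (frameC Φ i q) = F i q := by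
  rw [hdec q hq]
  simp only [dotC_add_left, dotC_smul_left, dotC_frameC h hq]
  fin_cases i <;> simp

lemma contDiffOn_component (hU : IsOpen U) (hΦ : ContDiffOn ℝ 3 Φ U)
    (h : IsOrthogonalCurvilinear Φ U) (hΦΩ : ∀ q ∈ U, Φ q ∈ Ω) (hf : VContDiffOn 2 f Ω)
    (hF : ∀ q ∈ U, ∀ i, dotC (f (Φ q)) (frameC Φ i q) = F i q) (i : Fin 3) :
    ContDiffOn ℝ 2 (F i) U := by
  have hfΦ (a) : ContDiffOn ℝ 2 (fun s => f (Φ s) a) U :=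
    (hf a).comp (hΦ.of_le (by norm_num)) hΦΩ
  have hT (a) := contDiffOn_tangentC hU hΦ (m := 2) (by norm_num) i a
  have hA : ContDiffOn ℝ 2 (fun s => (hC Φ i s)⁻¹ * dotC (f (Φ s)) (tangentC Φ i s)) U :=
    ((contDiffOn_hC hU hΦ h i).inv fun s hs => hC_ne_zero h hs i).mul
      ((((hfΦ 0).mul (hT 0)).add ((hfΦ 1).mul (hT 1))).add ((hfΦ 2).mul (hT 2)))
  refine hA.congr fun s hs => ?_
  rw [← hF s hs, frameC_eq, dotC_smul_right]

lemma curl_component (hU : IsOpen U) (hΦ : ContDiffOn ℝ 2 Φ U)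
    (h : IsOrthogonalCurvilinear Φ U) (hrh : IsRightHanded Φ U) (hq : q ∈ U)
    (hf : ∀ a, DifferentiableAt ℝ (fun p => f p a) (Φ q))
    {i j k : Fin 3} (hj : j = i + 1) (hk : k = i + 2) :
    hC Φ i q * hC Φ j q * dotC (curl f (Φ q)) (frameC Φ k q) =
      pd i (fun s => hC Φ j s * dotC (f (Φ s)) (frameC Φ j s)) q -
        pd j (fun s => hC Φ i s * dotC (f (Φ s)) (frameC Φ i s)) q := by
  have e (i : Fin 3) : Set.EqOn (fun s => hC Φ i s * dotC (f (Φ s)) (frameC Φ i s))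
      (fun s => dotC (f (Φ s)) (tangentC Φ i s)) U := fun s hs => by
    simp only [tangentC_eq h hs, dotC_smul_right]
  rw [pd_congr_of_eqOn hU hq (e i), pd_congr_of_eqOn hU hq (e j),
    pd_dotC_tangentC_sub hU hΦ hq hf, crossC_tangentC h hrh hq hj hk, dotC_smul_right]

lemma div_eq (hU : IsOpen U) (hΦ : ContDiffOn ℝ 2 Φ U)
    (h : IsOrthogonalCurvilinear Φ U) (hrh : IsRightHanded Φ U) (hq : q ∈ U)
    (hf : ∀ a, DifferentiableAt ℝ (fun p => f p a) (Φ q))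
    {i j k : Fin 3} (hj : j = i + 1) (hk : k = i + 2) :
    hC Φ i q * hC Φ j q * hC Φ k q * div3 f (Φ q) =
      pd i (fun s => hC Φ j s * hC Φ k s * dotC (f (Φ s)) (frameC Φ i s)) q +
        pd j (fun s => hC Φ i s * hC Φ k s * dotC (f (Φ s)) (frameC Φ j s)) q +
        pd k (fun s => hC Φ i s * hC Φ j s * dotC (f (Φ s)) (frameC Φ k s)) q := by
  have hjk : k = j + 1 ∧ i = j + 2 ∧ i = k + 1 ∧ j = k + 2 := by
    subst hj hk; revert i; decide
  obtain ⟨h1, h2, h3, h4⟩ := hjk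
  have e1 : Set.EqOn (fun s => hC Φ j s * hC Φ k s * dotC (f (Φ s)) (frameC Φ i s))
      (fun s => dotC (f (Φ s)) (crossC (tangentC Φ j s) (tangentC Φ k s))) U := fun s hs => by
    simp only [crossC_tangentC h hrh hs h1 h2, dotC_smul_right]
  have e2 : Set.EqOn (fun s => hC Φ i s * hC Φ k s * dotC (f (Φ s)) (frameC Φ j s))
      (fun s => dotC (f (Φ s)) (crossC (tangentC Φ k s) (tangentC Φ i s))) U := fun s hs => by
    simp only [crossC_tangentC h hrh hs h3 h4, dotC_smul_right, mul_comm (hC Φ k s)]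
  have e3 : Set.EqOn (fun s => hC Φ i s * hC Φ j s * dotC (f (Φ s)) (frameC Φ k s))
      (fun s => dotC (f (Φ s)) (crossC (tangentC Φ i s) (tangentC Φ j s))) U := fun s hs => by
    simp only [crossC_tangentC h hrh hs hj hk, dotC_smul_right]
  rw [pd_congr_of_eqOn hU hq e1, pd_congr_of_eqOn hU hq e2, pd_congr_of_eqOn hU hq e3,
    sum_pd_dotC_crossC hU hΦ hq hf, crossC_tangentC h hrh hq h1 h2, tangentC_eq h hq,
    dotC_smul_right, dotC_smul_left, dotC_frameC h hq, if_pos rfl]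
  ring

lemma lame_component (mu lam : ℝ) (hU : IsOpen U) (hΩ : IsOpen Ω) (hΦ : ContDiffOn ℝ 3 Φ U)
    (h : IsOrthogonalCurvilinear Φ U) (hrh : IsRightHanded Φ U)
    (hΦΩ : ∀ q ∈ U, Φ q ∈ Ω) (hf : VContDiffOn 2 f Ω)
    (hF : ∀ q ∈ U, ∀ i, dotC (f (Φ q)) (frameC Φ i q) = F i q) (hq : q ∈ U)
    {i j k : Fin 3} (hj : j = i + 1) (hk : k = i + 2) :
    dotC ((mu : ℂ) • (grad (div3 f) (Φ q) - curl (curl f) (Φ q)) +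
        ((mu : ℂ) + (lam : ℂ)) • grad (div3 f) (Φ q)) (frameC Φ i q) =
      lameCurvExpr Φ F mu lam i j k q := by
  obtain ⟨h1, h2, h3, h4⟩ : k = j + 1 ∧ i = j + 2 ∧ i = k + 1 ∧ j = k + 2 := by
    subst hj hk; revert i; decide
  have hΦ2 : ContDiffOn ℝ 2 Φ U := hΦ.of_le (by norm_num)
  have hdΦ : DifferentiableAt ℝ Φ q :=
    (hΦ.contDiffAt (hU.mem_nhds hq)).differentiableAt (by norm_num)
  have hh := hC_ne_zero h hq
  have hhC := contDiffOn_hC hU hΦ h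
  have hFC := contDiffOn_component hU hΦ h hΦΩ hf hF
  have hdf : ∀ s ∈ U, ∀ a, DifferentiableAt ℝ (fun p => f p a) (Φ s) := fun s hs a =>
    ((hf a).contDiffAt (hΩ.mem_nhds (hΦΩ s hs))).differentiableAt (by norm_num)
  have hdh (a : Fin 3) : DifferentiableAt ℝ (hC Φ a) q :=
    ((hhC a).contDiffAt (hU.mem_nhds hq)).differentiableAt (by norm_num)
  have hdpd {g : P3 → ℂ} (hg : ContDiffOn ℝ 2 g U) (a : Fin 3) : DifferentiableAt ℝ (pd a g) q :=
    ((contDiffOn_pd hU hg (m := 1) (by norm_num) a).contDiffAt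
      (hU.mem_nhds hq)).differentiableAt (by norm_num)
  -- the gradient of the divergence
  have hgrad : hC Φ i q * dotC (grad (div3 f) (Φ q)) (frameC Φ i q) =
      pd i (fun s => div3 f (Φ s)) q := by
    rw [pd_comp (((contDiffOn_div3 hΩ hf).contDiffAt
      (hΩ.mem_nhds (hΦΩ q hq))).differentiableAt (by norm_num)) hdΦ, ← tangentC,
      tangentC_eq h hq, dotC_smul_right]
  have hdiv : Set.EqOn (fun s => div3 f (Φ s)) (fun s =>
      1 / (hC Φ i s * hC Φ j s * hC Φ k s) * pd i (fun s => hC Φ j s * hC Φ k s * F i s) s +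
      1 / (hC Φ i s * hC Φ j s * hC Φ k s) * pd j (fun s => hC Φ i s * hC Φ k s * F j s) s +
      1 / (hC Φ i s * hC Φ j s * hC Φ k s) * pd k (fun s => hC Φ i s * hC Φ j s * F k s) s)
      U := fun s hs => by
    have hd := div_eq hU hΦ2 h hrh hs (hdf s hs) hj hk
    have hc (a b c d : Fin 3) : pd d (fun s => hC Φ a s * hC Φ b s * F c s) s =
        pd d (fun s => hC Φ a s * hC Φ b s * dotC (f (Φ s)) (frameC Φ c s)) s :=
      pd_congr_of_eqOn hU hs (fun t ht => by simp only [hF t ht]) d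
    have hne := hC_ne_zero h hs
    have := hne i
    have := hne j
    have := hne k
    simp only [hc, ← mul_add, ← hd]
    field_simp
  have hdinv : DifferentiableAt ℝ (fun s => 1 / (hC Φ i s * hC Φ j s * hC Φ k s)) q := by
    simp only [one_div]
    exact (((hdh i).mul (hdh j)).mul (hdh k)).inv (mul_ne_zero (mul_ne_zero (hh i) (hh j)) (hh k))
  have hdD (a b c d : Fin 3) := hdinv.fun_mul
    (hdpd (((hhC a).mul (hhC b)).mul (hFC c)) d)
  have hgd := hgrad.trans (pd_congr_of_eqOn hU hq hdiv i)
  rw [pd_add ((hdD j k i i).fun_add (hdD i k j j)) (hdD i j k k),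
    pd_add (hdD j k i i) (hdD i k j j)] at hgd
  -- the iterated curl
  have hcc := curl_component hU hΦ2 h hrh hq (f := curl f) (fun a =>
    ((contDiffOn_curl hΩ hf a).contDiffAt (hΩ.mem_nhds (hΦΩ q hq))).differentiableAt
      (by norm_num)) h1 h2
  have hcurl {a b c : Fin 3} (hb : b = a + 1) (hc : c = a + 2) :
      Set.EqOn (fun s => hC Φ c s * dotC (curl f (Φ s)) (frameC Φ c s)) (fun s =>
        hC Φ c s / (hC Φ a s * hC Φ b s) * pd a (fun s => hC Φ b s * F b s) s -
        hC Φ c s / (hC Φ a s * hC Φ b s) * pd b (fun s => hC Φ a s * F a s) s) U :=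
      fun s hs => by
    have hd := curl_component hU hΦ2 h hrh hs (hdf s hs) hb hc
    have hp (a d : Fin 3) : pd d (fun s => hC Φ a s * F a s) s =
        pd d (fun s => hC Φ a s * dotC (f (Φ s)) (frameC Φ a s)) s :=
      pd_congr_of_eqOn hU hs (fun t ht => by simp only [hF t ht]) d
    have := hC_ne_zero h hs a
    have := hC_ne_zero h hs b
    simp only [hp, ← mul_sub, ← hd]
    field_simp
  have hdq (a b c : Fin 3) : DifferentiableAt ℝ (fun s => hC Φ c s / (hC Φ a s * hC Φ b s)) q := by
    simp only [div_eq_mul_inv]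
    exact (hdh c).fun_mul (((hdh a).fun_mul (hdh b)).inv (mul_ne_zero (hh a) (hh b)))
  have hdC (a b c d e : Fin 3) := (hdq a b c).fun_mul (hdpd ((hhC d).mul (hFC d)) e)
  rw [pd_congr_of_eqOn hU hq (hcurl hj hk), pd_congr_of_eqOn hU hq (hcurl h3 h4),
    pd_sub (hdC i j k j i) (hdC i j k i j), pd_sub (hdC k i j i k) (hdC k i j k i)] at hcc
  simp only [mul_comm (hC Φ k _) (hC Φ i _)] at hcc
  rw [dotC_add_left, dotC_smul_left, dotC_smul_left, dotC_sub_left,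
    eq_div_of_mul_eq (hh i) ((mul_comm _ _).trans hgd),
    eq_div_of_mul_eq (mul_ne_zero (hh j) (hh k)) ((mul_comm _ _).trans hcc)]
  simp only [lameCurvExpr]
  push_cast
  ring

end Lame

/-- Let `Φ` be a `C³` orthogonal curvilinear coordinate map on the
open set `U`, with metric coefficients `hᵢ` and right-handed frame `uᵢ`, let `μ > 0`,
`λ > −(2/3)μ`, and let `f⃗ ∈ C²(Ω; ℂ³)` with `Φ(U) ⊆ Ω` have curvilinear components
`F₁, F₂, F₃` (indexed here by `F 0, F 1, F 2`).  Then for every `q ∈ U` the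
`uᵢ`-components of the Lamé–Navier operator
`ℒ_{λ,μ}[f⃗] = μ(grad[div[f⃗]] − curl[curl[f⃗]]) + (μ+λ) grad[div[f⃗]]` at `Φ(q)`
are given by the classical curvilinear expression and its cyclic permutations. -/
theorem lame_curvilinear (mu lam : ℝ) (hmu : 0 < mu) (hlam : -(2/3) * mu < lam)
    (U Ω : Set P3) (hU : IsOpen U) (hΩ : IsOpen Ω)
    (Φ : P3 → P3) (hΦ : ContDiffOn ℝ 3 Φ U)
    (horth : IsOrthogonalCurvilinear Φ U) (hrh : IsRightHanded Φ U)
    (hΦΩ : ∀ q ∈ U, Φ q ∈ Ω)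
    (fv : P3 → V3) (hfv : VContDiffOn 2 fv Ω)
    (F : Fin 3 → P3 → ℂ)
    (hdec : ∀ q ∈ U, fv (Φ q) =
      F 0 q • frameC Φ 0 q + F 1 q • frameC Φ 1 q + F 2 q • frameC Φ 2 q) :
    ∀ q ∈ U,
      dotC ((mu : ℂ) • (grad (div3 fv) (Φ q) - curl (curl fv) (Φ q)) +
            ((mu : ℂ) + (lam : ℂ)) • grad (div3 fv) (Φ q)) (frameC Φ 0 q) =
          lameCurvExpr Φ F mu lam 0 1 2 q ∧
        dotC ((mu : ℂ) • (grad (div3 fv) (Φ q) - curl (curl fv) (Φ q)) +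
            ((mu : ℂ) + (lam : ℂ)) • grad (div3 fv) (Φ q)) (frameC Φ 1 q) =
          lameCurvExpr Φ F mu lam 1 2 0 q ∧
        dotC ((mu : ℂ) • (grad (div3 fv) (Φ q) - curl (curl fv) (Φ q)) +
            ((mu : ℂ) + (lam : ℂ)) • grad (div3 fv) (Φ q)) (frameC Φ 2 q) =
          lameCurvExpr Φ F mu lam 2 0 1 q := by
  intro q hq
  have hF := fun q hq i => dotC_frameC_of_decomp horth hdec (q := q) hq i
  exact ⟨lame_component mu lam hU hΩ hΦ horth hrh hΦΩ hfv hF hq rfl rfl,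
    lame_component mu lam hU hΩ hΦ horth hrh hΦΩ hfv hF hq rfl rfl,
    lame_component mu lam hU hΩ hΦ horth hrh hΦΩ hfv hF hq rfl rfl⟩
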